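/- Let λ ∈ ℝ, α > 0, β > 0, and let f₀ be the generalized inverse Gaussian density f₀(x) = x^{λ−1} exp(−(β/2)(x/α + α/x)) / C(λ, α, β) on (0,∞), where C(λ, α, β) = ∫₀^∞ x^{λ−1} exp(−(β/2)(x/α + α/x)) dx. Then for every probability density f on (0,∞) such that x·f(x), x⁻¹·f(x), (ln x)·f(x) and f(x)·ln f(x) are integrable on (0,∞), and such that f has the same arithmetic mean, the same harmonic-mean constraint ∫₀^∞ x⁻¹ f, and the same geometric-mean constraint ∫₀^∞ ln x · f as f₀, the differential entropy satisfies −∫₀^∞ f(x) ln f(x) dx ≤ −∫₀^∞ f₀(x) ln f₀(x) dx. That is, among all densities on the positive real line with prescribed arithmetic, geometric and harmonic means, the GIG density maximizes differential entropy. -/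

import Mathlib

open MeasureTheory Real Set

/-- The unnormalized generalized inverse Gaussian weight is integrable on `(0,∞)`. -/
theorem integrableOn_rpow_mul_exp_neg_add_div (s : ℝ) {α β : ℝ} (hα : 0 < α) (hβ : 0 < β) :
    IntegrableOn (fun x : ℝ => x ^ s * exp (-(β / 2) * (x / α + α / x))) (Ioi 0) := by
  obtain ⟨n, hn⟩ := exists_nat_gt (-1 - s)
  have hdom : IntegrableOn (fun x : ℝ => (n.factorial / (β / 2 * α) ^ n) *
      (x ^ (s + n) * exp (-(β / (2 * α)) * x ^ (1 : ℝ)))) (Ioi 0) :=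
    (integrableOn_rpow_mul_exp_neg_mul_rpow (by linarith) one_pos (by positivity)).const_mul _
  refine Integrable.mono' hdom (by fun_prop) ?_
  refine (ae_restrict_mem measurableSet_Ioi).mono fun x (hx : 0 < x) => ?_
  have hy : 0 < β / 2 * α / x := by positivity
  have hpow : exp (-(β / 2 * α / x)) ≤ n.factorial / (β / 2 * α) ^ n * x ^ n := by
    have h := pow_div_factorial_le_exp _ hy.le n
    rw [exp_neg]
    calc (exp (β / 2 * α / x))⁻¹ ≤ ((β / 2 * α / x) ^ n / n.factorial)⁻¹ :=
          inv_anti₀ (by positivity) h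
      _ = _ := by rw [div_pow]; field_simp
  have hsplit : exp (-(β / 2) * (x / α + α / x)) =
      exp (-(β / 2 * α / x)) * exp (-(β / (2 * α)) * x) := by
    rw [← exp_add]; congr 1; field_simp; ring
  rw [norm_of_nonneg (by positivity), hsplit, rpow_one, rpow_add hx, rpow_natCast]
  calc x ^ s * (exp (-(β / 2 * α / x)) * exp (-(β / (2 * α)) * x))
      ≤ x ^ s * ((n.factorial / (β / 2 * α) ^ n * x ^ n) * exp (-(β / (2 * α)) * x)) := by
        gcongr
    _ = _ := by ring

theorem abs_log_le_add_inv {x : ℝ} (hx : 0 < x) : |log x| ≤ x + x⁻¹ := by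
  have h₁ := log_le_sub_one_of_pos hx
  have h₂ := one_sub_inv_le_log_of_pos hx
  have h₃ := inv_pos.2 hx
  rw [abs_le]
  constructor <;> linarith

theorem integrableOn_log_mul {h : ℝ → ℝ} (h_int : IntegrableOn h (Ioi 0))
    (h_id : IntegrableOn (fun x : ℝ => x * h x) (Ioi 0))
    (h_inv : IntegrableOn (fun x : ℝ => x⁻¹ * h x) (Ioi 0)) :
    IntegrableOn (fun x : ℝ => log x * h x) (Ioi 0) := by
  refine Integrable.mono' (h_id.norm.add h_inv.norm)
    (measurable_log.aestronglyMeasurable.mul h_int.aestronglyMeasurable) ?_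
  refine (ae_restrict_mem measurableSet_Ioi).mono fun x (hx : 0 < x) => ?_
  simp only [Pi.add_apply, norm_mul, norm_eq_abs, abs_inv, abs_of_pos hx, ← add_mul]
  gcongr
  exact abs_log_le_add_inv hx

/-- Gibbs' inequality, pointwise. -/
theorem mul_log_add_sub_le_mul_log {a b : ℝ} (ha : 0 ≤ a) (hb : 0 < b) :
    a * log b + (a - b) ≤ a * log a := by
  rcases ha.eq_or_lt with rfl | ha
  · simpa using hb.le
  · have h := mul_le_mul_of_nonneg_left (log_le_sub_one_of_pos (div_pos hb ha)) ha.le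
    rw [log_div hb.ne' ha.ne', mul_sub, mul_sub, mul_div_cancel₀ _ ha.ne'] at h
    linarith

/-- Gibbs' inequality for densities of equal mass. -/
theorem integral_mul_log_le_integral_mul_log {X : Type*} [MeasurableSpace X] {μ : Measure X}
    {f g : X → ℝ} (hf : Integrable f μ) (hg : Integrable g μ)
    (hfg : ∫ x, f x ∂μ = ∫ x, g x ∂μ) (hf_nonneg : ∀ᵐ x ∂μ, 0 ≤ f x) (hg_pos : ∀ᵐ x ∂μ, 0 < g x)
    (hf_log : Integrable (fun x => f x * log (f x)) μ)
    (hfg_log : Integrable (fun x => f x * log (g x)) μ) :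
    ∫ x, f x * log (g x) ∂μ ≤ ∫ x, f x * log (f x) ∂μ := by
  have hle : ∫ x, (f x * log (g x) + (f x - g x)) ∂μ ≤ ∫ x, f x * log (f x) ∂μ := by
    refine integral_mono_ae (hfg_log.add (hf.sub hg)) hf_log ?_
    filter_upwards [hf_nonneg, hg_pos] with x hx hx' using mul_log_add_sub_le_mul_log hx hx'
  rwa [integral_add (g := fun x => f x - g x) hfg_log (hf.sub hg), integral_sub hf hg, hfg, sub_self, add_zero] at hle

/-- Integrating the logarithm of a generalized inverse Gaussian density against `h` only involves
the mass of `h` and its logarithmic, first and inverse moments. -/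
theorem integrableOn_and_integral_mul_gig_log {h : ℝ → ℝ} (h_int : IntegrableOn h (Ioi 0))
    (h_id : IntegrableOn (fun x : ℝ => x * h x) (Ioi 0))
    (h_inv : IntegrableOn (fun x : ℝ => x⁻¹ * h x) (Ioi 0))
    (h_log : IntegrableOn (fun x : ℝ => log x * h x) (Ioi 0)) (a b c d : ℝ) :
    IntegrableOn (fun x => h x * (a * log x + b * x + c * x⁻¹ + d)) (Ioi 0) ∧
      ∫ x in Ioi (0 : ℝ), h x * (a * log x + b * x + c * x⁻¹ + d) =
        a * (∫ x in Ioi (0 : ℝ), log x * h x) + b * (∫ x in Ioi (0 : ℝ), x * h x) +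
          c * (∫ x in Ioi (0 : ℝ), x⁻¹ * h x) + d * ∫ x in Ioi (0 : ℝ), h x := by
  have heq : (fun x => h x * (a * log x + b * x + c * x⁻¹ + d)) = fun x =>
      a * (log x * h x) + b * (x * h x) + c * (x⁻¹ * h x) + d * h x := by
    ext x; ring
  have ha := h_log.const_mul a
  have hb := h_id.const_mul b
  have hc := h_inv.const_mul c
  have hd := h_int.const_mul d
  rw [heq]
  have hab := ha.fun_add hb
  have habc := hab.fun_add hc
  refine ⟨habc.fun_add hd, ?_⟩
  rw [integral_add habc hd, integral_add hab hc, integral_add ha hb]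
  simp only [integral_const_mul]

/-- Among all probability densities on `(0,∞)` with prescribed
arithmetic, geometric and harmonic means, the generalized inverse Gaussian density
`f₀ x = x^(λ-1) * exp (-(β/2)(x/α + α/x)) / C(λ,α,β)` maximizes the differential
entropy `-∫ f log f`. -/
theorem gig_maximizes_entropy
    (lam α β : ℝ) (hα : 0 < α) (hβ : 0 < β)
    (C : ℝ)
    (hC_def : C = ∫ x in Ioi (0:ℝ), x ^ (lam - 1) * exp (-(β / 2) * (x / α + α / x)))
    (f₀ : ℝ → ℝ)
    (hf₀_def : ∀ x ∈ Ioi (0:ℝ),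
      f₀ x = x ^ (lam - 1) * exp (-(β / 2) * (x / α + α / x)) / C)
    (f : ℝ → ℝ) (hf_meas : Measurable f) (hf_nonneg : ∀ x ∈ Ioi (0:ℝ), 0 ≤ f x)
    (hf_norm : ∫ x in Ioi (0:ℝ), f x = 1)
    (hf_int₁ : IntegrableOn (fun x : ℝ => x * f x) (Ioi 0))
    (hf_int₂ : IntegrableOn (fun x : ℝ => x⁻¹ * f x) (Ioi 0))
    (hf_int₃ : IntegrableOn (fun x : ℝ => Real.log x * f x) (Ioi 0))
    (hf_int₄ : IntegrableOn (fun x : ℝ => f x * Real.log (f x)) (Ioi 0))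
    (h_arith : ∫ x in Ioi (0:ℝ), x * f x = ∫ x in Ioi (0:ℝ), x * f₀ x)
    (h_harm : ∫ x in Ioi (0:ℝ), x⁻¹ * f x = ∫ x in Ioi (0:ℝ), x⁻¹ * f₀ x)
    (h_geom : ∫ x in Ioi (0:ℝ), Real.log x * f x
      = ∫ x in Ioi (0:ℝ), Real.log x * f₀ x) :
    -∫ x in Ioi (0:ℝ), f x * Real.log (f x)
      ≤ -∫ x in Ioi (0:ℝ), f₀ x * Real.log (f₀ x) := by
  have hg := integrableOn_rpow_mul_exp_neg_add_div (lam - 1) hα hβ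
  have hC : 0 < C := by
    rw [hC_def, setIntegral_pos_iff_support_of_nonneg_ae _ hg]
    · refine lt_of_lt_of_le (by simp : 0 < volume (Ioi (0 : ℝ))) (measure_mono fun x hx => ⟨?_, hx⟩)
      have hx : 0 < x := hx
      exact (by positivity : 0 < x ^ (lam - 1) * exp (-(β / 2) * (x / α + α / x))).ne'
    · refine (ae_restrict_mem measurableSet_Ioi).mono fun x (hx : 0 < x) => ?_
      simp only [Pi.zero_apply]
      positivity
  have hf₀_pos : ∀ x ∈ Ioi (0 : ℝ), 0 < f₀ x := fun x hx => by
    have hx' : 0 < x := hx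
    rw [hf₀_def x hx]
    positivity
  have hf₀_int : IntegrableOn f₀ (Ioi 0) :=
    IntegrableOn.congr_fun (hg.div_const C) (fun x hx => (hf₀_def x hx).symm) measurableSet_Ioi
  have hf₀_norm : ∫ x in Ioi (0 : ℝ), f₀ x = 1 := by
    rw [setIntegral_congr_fun measurableSet_Ioi hf₀_def, integral_div, ← hC_def, div_self hC.ne']
  have hf₀_id : IntegrableOn (fun x => x * f₀ x) (Ioi 0) := by
    refine IntegrableOn.congr_fun
      ((integrableOn_rpow_mul_exp_neg_add_div (lam - 1 + 1) hα hβ).div_const C)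
      (fun x hx => ?_) measurableSet_Ioi
    have hx' : 0 < x := hx
    simp only [hf₀_def x hx, rpow_add hx', rpow_one]
    ring
  have hf₀_inv : IntegrableOn (fun x => x⁻¹ * f₀ x) (Ioi 0) := by
    refine IntegrableOn.congr_fun
      ((integrableOn_rpow_mul_exp_neg_add_div (lam - 1 + -1) hα hβ).div_const C)
      (fun x hx => ?_) measurableSet_Ioi
    have hx' : 0 < x := hx
    simp only [hf₀_def x hx, rpow_add hx', rpow_neg_one]
    ring
  have hf₀_log : ∀ x ∈ Ioi (0 : ℝ), log (f₀ x) =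
      (lam - 1) * log x + -(β / (2 * α)) * x + -(β * α / 2) * x⁻¹ + -log C := fun x hx => by
    have hx' : 0 < x := hx
    rw [hf₀_def x hx, log_div (by positivity) hC.ne', log_mul (by positivity) (by positivity),
      log_rpow hx', log_exp]
    field_simp
    ring
  have hf_int : IntegrableOn f (Ioi 0) :=
    Integrable.of_integral_ne_zero (by rw [hf_norm]; exact one_ne_zero)
  obtain ⟨hcross, hcross_eq⟩ := integrableOn_and_integral_mul_gig_log hf_int hf_int₁ hf_int₂ hf_int₃
    (lam - 1) (-(β / (2 * α))) (-(β * α / 2)) (-log C)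
  have hself_eq := (integrableOn_and_integral_mul_gig_log hf₀_int hf₀_id hf₀_inv
    (integrableOn_log_mul hf₀_int hf₀_id hf₀_inv)
    (lam - 1) (-(β / (2 * α))) (-(β * α / 2)) (-log C)).2
  have hcongr (h : ℝ → ℝ) : EqOn (fun x => h x * log (f₀ x)) (fun x => h x *
      ((lam - 1) * log x + -(β / (2 * α)) * x + -(β * α / 2) * x⁻¹ + -log C)) (Ioi 0) :=
    fun x hx => congrArg (h x * ·) (hf₀_log x hx)
  have hgibbs := integral_mul_log_le_integral_mul_log hf_int hf₀_int (hf_norm.trans hf₀_norm.symm)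
    ((ae_restrict_mem measurableSet_Ioi).mono hf_nonneg)
    ((ae_restrict_mem measurableSet_Ioi).mono hf₀_pos) hf_int₄
    (hcross.congr_fun (hcongr f).symm measurableSet_Ioi)
  rw [setIntegral_congr_fun measurableSet_Ioi (hcongr f), hcross_eq, h_arith, h_harm, h_geom,
    hf_norm.trans hf₀_norm.symm, ← hself_eq, ← setIntegral_congr_fun measurableSet_Ioi (hcongr f₀)]
    at hgibbs
  exact neg_le_neg hgibbs
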